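/- Exactly 9 of the 21 isomorphism classes of connected simple graphs on 5 vertices are universally solvable; that is, the set of isomorphism classes of connected simple graphs on a 5-element vertex set whose members are universally solvable has cardinality 9. -/

import Mathlib

open scoped Classical in
/-- The neighborhood matrix of a simple graph `G` over the field `ℤ/2ℤ`:
its `(u, v)` entry is `1` if `u = v` or `u` is adjacent to `v`, and `0` otherwise. -/
noncomputable def neighborhoodMatrix {V : Type*} [Fintype V]
    (G : SimpleGraph V) : Matrix V V (ZMod 2) :=
  fun u v => if u = v ∨ G.Adj u v then 1 else 0

/-- Lights Out on `G` is universally solvable: every configuration `b` can be obtained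
by pressing some set of vertices `x`. -/
def UniversallySolvable {V : Type*} [Fintype V] (G : SimpleGraph V) : Prop :=
  ∀ b : V → ZMod 2, ∃ x : V → ZMod 2, (neighborhoodMatrix G).mulVec x = b

/-- The setoid on labeled simple graphs with vertex set `V` whose equivalence classes are
the isomorphism classes of simple graphs. -/
def graphIsoSetoid (V : Type*) : Setoid (SimpleGraph V) where
  r G H := Nonempty (G ≃g H)
  iseqv := ⟨fun _ => ⟨SimpleGraph.Iso.refl⟩,
    fun ⟨e⟩ => ⟨e.symm⟩, fun ⟨e⟩ ⟨f⟩ => ⟨e.trans f⟩⟩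

section Invariance

variable {V W : Type*} [Fintype V] [Fintype W]

theorem neighborhoodMatrix_mulVec_apply [DecidableEq V] (G : SimpleGraph V) [DecidableRel G.Adj]
    (x : V → ZMod 2) (u : V) :
    (neighborhoodMatrix G).mulVec x u = ∑ v, if u = v ∨ G.Adj u v then x v else 0 := by
  simp only [Matrix.mulVec, dotProduct, neighborhoodMatrix, ite_mul, one_mul, zero_mul]

theorem universallySolvable_iff_forall_mulVec_eq_zero (G : SimpleGraph V) :
    UniversallySolvable G ↔ ∀ x, (neighborhoodMatrix G).mulVec x = 0 → x = 0 := by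
  have h : UniversallySolvable G ↔ Function.Surjective (neighborhoodMatrix G).mulVecLin := Iff.rfl
  rw [h, ← Finite.injective_iff_surjective, injective_iff_map_eq_zero]
  rfl

/-- Lights Out is universally solvable iff no nonempty set of presses leaves all lights
unchanged. -/
theorem universallySolvable_iff [DecidableEq V] (G : SimpleGraph V) [DecidableRel G.Adj] :
    UniversallySolvable G ↔ ∀ x : V → ZMod 2,
      (∀ u, (∑ v, if u = v ∨ G.Adj u v then x v else 0) = 0) → ∀ u, x u = 0 := by
  simp only [universallySolvable_iff_forall_mulVec_eq_zero, funext_iff,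
    neighborhoodMatrix_mulVec_apply, Pi.zero_apply]

theorem UniversallySolvable.of_iso {G : SimpleGraph V} {H : SimpleGraph W} (e : G ≃g H)
    (hG : UniversallySolvable G) : UniversallySolvable H := by
  classical
  rw [universallySolvable_iff] at hG ⊢
  intro x hx u
  have := hG (x ∘ e) (fun v => ?_) (e.symm u)
  · simpa using this
  · refine (Fintype.sum_equiv e.toEquiv _ _ fun w => ?_).trans (hx (e v))
    simp [e.map_adj_iff]

/-- The sum of `deg u * deg v` over all ordered pairs of adjacent vertices, that is, twice the
second Zagreb index. -/
def zagrebSum (G : SimpleGraph V) [DecidableRel G.Adj] : ℕ :=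
  ∑ u, ∑ v, if G.Adj u v then G.degree u * G.degree v else 0

theorem zagrebSum_eq_of_iso {G : SimpleGraph V} {H : SimpleGraph W} [DecidableRel G.Adj]
    [DecidableRel H.Adj] (e : G ≃g H) : zagrebSum G = zagrebSum H := by
  refine Fintype.sum_equiv e.toEquiv _ _ fun u => Fintype.sum_equiv e.toEquiv _ _ fun v => ?_
  simp [e.map_adj_iff]

end Invariance

/-- The position of the edge `uv` in the colexicographic order on two-element sets. -/
def edgeIndex (u v : Fin 5) : ℕ :=
  max u.val v.val * (max u.val v.val - 1) / 2 + min u.val v.val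

theorem edgeIndex_comm (u v : Fin 5) : edgeIndex u v = edgeIndex v u := by
  simp only [edgeIndex, max_comm, min_comm]

/-- The graph on five vertices whose edges are the positions of the binary digits `1` of `c`. -/
def bitGraph (c : ℕ) : SimpleGraph (Fin 5) where
  Adj u v := u ≠ v ∧ c.testBit (edgeIndex u v) = true
  symm := ⟨fun u v h => ⟨h.1.symm, edgeIndex_comm u v ▸ h.2⟩⟩
  loopless := ⟨fun _ h => h.1 rfl⟩

instance (c : ℕ) : DecidableRel (bitGraph c).Adj :=
  fun u v => inferInstanceAs (Decidable (u ≠ v ∧ c.testBit (edgeIndex u v) = true))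

/-- The two-element subsets of `Fin 5` in colexicographic order. -/
def edgeEnds : Fin 10 → Fin 5 × Fin 5 :=
  ![(0, 1), (0, 2), (1, 2), (0, 3), (1, 3), (2, 3), (0, 4), (1, 4), (2, 4), (3, 4)]

/-- The number whose binary digits record the edges of `G`. -/
def graphCode (G : SimpleGraph (Fin 5)) [DecidableRel G.Adj] : ℕ :=
  Nat.ofBits fun k => decide (G.Adj (edgeEnds k).1 (edgeEnds k).2)

theorem graphCode_lt (G : SimpleGraph (Fin 5)) [DecidableRel G.Adj] : graphCode G < 1024 :=
  Nat.ofBits_lt_two_pow _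

theorem exists_edgeEnds_of_ne :
    ∀ u v : Fin 5, u ≠ v → ∃ k : Fin 10, edgeIndex u v = k ∧
      (edgeEnds k = (u, v) ∨ edgeEnds k = (v, u)) := by
  decide

@[simp]
theorem bitGraph_graphCode (G : SimpleGraph (Fin 5)) [DecidableRel G.Adj] :
    bitGraph (graphCode G) = G := by
  ext u v
  change u ≠ v ∧ (graphCode G).testBit (edgeIndex u v) = true ↔ _
  rcases eq_or_ne u v with rfl | huv
  · simp
  · obtain ⟨k, hk, h⟩ := exists_edgeEnds_of_ne u v huv
    rw [hk, graphCode, Nat.testBit_ofBits_lt _ _ k.isLt]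
    rcases h with h | h <;> simp [h, huv, G.adj_comm]

/-- Codes of representatives of the classes of connected universally solvable graphs. -/
def solvableCode : Fin 9 → ℕ := ![75, 77, 87, 95, 222, 236, 237, 239, 507]

/-- Relabellings under which every code of a connected universally solvable graph can be lowered
to a value of `solvableCode`. -/
def relabellings : List (Equiv.Perm (Fin 5)) :=
  [.swap 0 1, .swap 1 2, .swap 2 3, .swap 3 4, .swap 0 1 * .swap 3 4, .swap 1 2 * .swap 3 4,
    .swap 0 3 * .swap 1 4]

instance (c : ℕ) (σ : Equiv.Perm (Fin 5)) : DecidableRel ((bitGraph c).comap σ).Adj :=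
  fun u v => inferInstanceAs (Decidable ((bitGraph c).Adj (σ u) (σ v)))

theorem exists_relabelling_or_solvableCode : ∀ c < 1024,
    (∃ σ ∈ relabellings, graphCode ((bitGraph c).comap σ) < c) ∨ (∃ i, solvableCode i = c) ∨
      ¬ (bitGraph c).Connected ∨ ¬ ∀ x : Fin 5 → ZMod 2,
        (∀ u, (∑ v, if u = v ∨ (bitGraph c).Adj u v then x v else 0) = 0) → ∀ u, x u = 0 := by
  decide +kernel

theorem connected_bitGraph_solvableCode : ∀ i, (bitGraph (solvableCode i)).Connected := by
  decide +kernel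

theorem universallySolvable_bitGraph_solvableCode (i : Fin 9) :
    UniversallySolvable (bitGraph (solvableCode i)) := by
  rw [universallySolvable_iff]
  revert i
  decide +kernel

theorem zagrebSum_bitGraph_solvableCode_injective :
    Function.Injective fun i => zagrebSum (bitGraph (solvableCode i)) := by
  decide +kernel

theorem exists_iso_bitGraph_solvableCode (c : ℕ) (hc : c < 1024) (h : (bitGraph c).Connected)
    (h' : UniversallySolvable (bitGraph c)) :
    ∃ i, Nonempty (bitGraph (solvableCode i) ≃g bitGraph c) := by
  induction c using Nat.strong_induction_on with
  | _ c ih =>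
    rcases exists_relabelling_or_solvableCode c hc with ⟨σ, -, hσ⟩ | ⟨i, hi⟩ | hn | hn
    · have e : bitGraph (graphCode ((bitGraph c).comap σ)) ≃g bitGraph c := by
        rw [bitGraph_graphCode]
        exact SimpleGraph.Iso.comap σ _
      obtain ⟨i, ⟨f⟩⟩ := ih _ hσ (graphCode_lt _) (e.connected_iff.2 h) (h'.of_iso e.symm)
      exact ⟨i, ⟨f.trans e⟩⟩
    · exact ⟨i, hi ▸ ⟨SimpleGraph.Iso.refl⟩⟩
    · exact absurd h hn
    · exact absurd ((universallySolvable_iff _).1 h') hn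

/-- Exactly 9 of the 21 isomorphism classes of connected simple graphs on 5 vertices are
universally solvable. -/
theorem card_universallySolvable_connected_classes_five :
    Nat.card {q : Quotient (graphIsoSetoid (Fin 5)) //
      ∀ G : SimpleGraph (Fin 5), Quotient.mk (graphIsoSetoid (Fin 5)) G = q →
        G.Connected ∧ UniversallySolvable G} = 9 := by
  rw [← Nat.card_fin 9]
  have hmem (i : Fin 9) (G : SimpleGraph (Fin 5))
      (hG : Quotient.mk (graphIsoSetoid (Fin 5)) G = Quotient.mk _ (bitGraph (solvableCode i))) :
      G.Connected ∧ UniversallySolvable G := by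
    obtain ⟨e⟩ := Quotient.exact hG
    exact ⟨e.connected_iff.2 (connected_bitGraph_solvableCode i),
      (universallySolvable_bitGraph_solvableCode i).of_iso e.symm⟩
  refine (Nat.card_eq_of_bijective (fun i => ⟨_, hmem i⟩)
    ⟨fun i j hij => ?_, fun ⟨q, hq⟩ => ?_⟩).symm
  · obtain ⟨e⟩ := Quotient.exact (Subtype.ext_iff.1 hij)
    exact zagrebSum_bitGraph_solvableCode_injective (zagrebSum_eq_of_iso e)
  · induction q using Quotient.inductionOn with
    | h G =>
      classical
      obtain ⟨h, h'⟩ := hq G rfl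
      rw [← bitGraph_graphCode G] at h h'
      obtain ⟨i, hi⟩ := exists_iso_bitGraph_solvableCode _ (graphCode_lt G) h h'
      rw [bitGraph_graphCode] at hi
      exact ⟨i, Subtype.ext (Quotient.sound hi)⟩
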